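/- Let n ≥ 2, 1 ≤ p ≤ 2, 1 < α < n and s ≥ 0. Suppose there is a constant C > 0 such that for every Schwartz function f on ℝⁿ and every finite Borel measure μ on ℝⁿ supported in B(0,1) with [μ]_α < ∞ one has (∫₀¹ ∫_{ℝⁿ} |e^{it√(−Δ)}f(x)|^p dμ(x) dt)^{1/p} ≤ C [μ]_α^{1/p} ‖f‖_{H^s}. Then s ≥ max{(n−α)/2, (n+2−α)/4} − 1/p. -/

import Mathlib

open MeasureTheory Real Metric
open scoped ENNReal RealInnerProductSpace

noncomputable section

abbrev E (n : ℕ) : Type := EuclideanSpace ℝ (Fin n)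

/-- The Frostman constant `[μ]_α = sup_{x,r>0} μ(B(x,r))/r^α`. -/
def frostman {d : ℕ} (μ : Measure (E d)) (α : ℝ) : ℝ≥0∞ :=
  ⨆ (x : E d) (r : ℝ) (_ : 0 < r), μ (Metric.ball x r) / ENNReal.ofReal (r ^ α)

/-- The Fourier transform `f̂(ξ) = ∫ e^{-2πi x·ξ} f(x) dx`. -/
def FT {n : ℕ} (f : E n → ℂ) (ξ : E n) : ℂ :=
  ∫ x, Complex.exp (((-2 * π * ⟪x, ξ⟫ : ℝ) : ℂ) * Complex.I) * f x

/-- The Sobolev norm `‖f‖_{H^s} = (∫ (1+|ξ|²)^s |f̂(ξ)|² dξ)^{1/2}`. -/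
def sobolevNorm {n : ℕ} (f : E n → ℂ) (s : ℝ) : ℝ :=
  (∫ ξ : E n, (1 + ‖ξ‖ ^ 2) ^ s * ‖FT f ξ‖ ^ 2) ^ (1/2 : ℝ)

/-- The half-wave propagator `e^{it√(-Δ)}f(x) = ∫ e^{2πi(x·ξ+t|ξ|)} f̂(ξ) dξ`. -/
def halfWave {n : ℕ} (f : E n → ℂ) (t : ℝ) (x : E n) : ℂ :=
  ∫ ξ : E n, Complex.exp (((2 * π * (⟪x, ξ⟫ + t * ‖ξ‖) : ℝ) : ℂ) * Complex.I) * FT f ξ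

/-- Orthogonality of the characters of a finite abelian group. -/
theorem addChar_sum_mul_conj {G : Type*} [AddCommGroup G] [Fintype G] [DecidableEq G] (j k : G) :
    ∑ ψ : AddChar G ℂ, ψ j * (starRingEnd ℂ) (ψ k) = if j = k then (Fintype.card G : ℂ) else 0 := by
  have h := AddChar.sum_apply_eq_ite (j - k)
  simp only [sub_eq_zero] at h
  rw [← h]
  refine Finset.sum_congr rfl fun ψ _ => ?_
  rw [← AddChar.map_neg_eq_conj, ← AddChar.map_add_eq_mul, sub_eq_add_neg]

theorem addChar_sum_norm_sq {G : Type*} [AddCommGroup G] [Fintype G] (v : G → ℂ) :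
    ∑ ψ : AddChar G ℂ, ‖∑ k, ψ k * v k‖ ^ 2 = Fintype.card G * ∑ k, ‖v k‖ ^ 2 := by
  classical
  have key : ∑ ψ : AddChar G ℂ, (∑ j, ψ j * v j) * (starRingEnd ℂ) (∑ k, ψ k * v k)
      = Fintype.card G * ∑ k, v k * (starRingEnd ℂ) (v k) := by
    simp only [map_sum, map_mul, Finset.sum_mul_sum]
    rw [Finset.sum_comm, Finset.mul_sum]
    refine Finset.sum_congr rfl fun j _ => ?_
    rw [Finset.sum_comm]
    have : ∀ k, ∑ ψ : AddChar G ℂ, ψ j * v j * ((starRingEnd ℂ) (ψ k) * (starRingEnd ℂ) (v k))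
        = (if j = k then (Fintype.card G : ℂ) else 0) * (v j * (starRingEnd ℂ) (v k)) := by
      intro k
      rw [← addChar_sum_mul_conj, Finset.sum_mul]
      exact Finset.sum_congr rfl fun ψ _ => by ring
    simp [this]
  simp only [Complex.mul_conj'] at key
  exact_mod_cast key

theorem addChar_le_sum_norm_rpow {G : Type*} [AddCommGroup G] [Fintype G] (v : G → ℂ)
    {p : ℝ} (hp : 1 ≤ p) (j : G) :
    Fintype.card G * ‖v j‖ ^ p ≤ ∑ ψ : AddChar G ℂ, ‖∑ k, ψ k * v k‖ ^ p := by
  classical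
  have hN : (0 : ℝ) < Fintype.card G := by exact_mod_cast Fintype.card_pos_iff.2 ⟨j⟩
  have key : ∑ ψ : AddChar G ℂ, (starRingEnd ℂ) (ψ j) * (∑ k, ψ k * v k)
      = Fintype.card G * v j := by
    simp only [Finset.mul_sum]
    rw [Finset.sum_comm]
    have : ∀ k, ∑ ψ : AddChar G ℂ, (starRingEnd ℂ) (ψ j) * (ψ k * v k)
        = (if k = j then (Fintype.card G : ℂ) else 0) * v k := by
      intro k
      rw [← addChar_sum_mul_conj, Finset.sum_mul]
      exact Finset.sum_congr rfl fun ψ _ => by ring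
    simp [this]
  have h1 : ‖v j‖ ≤ ∑ ψ : AddChar G ℂ, (Fintype.card G : ℝ)⁻¹ * ‖∑ k, ψ k * v k‖ := by
    rw [← Finset.mul_sum, le_inv_mul_iff₀ hN]
    calc (Fintype.card G : ℝ) * ‖v j‖ = ‖(Fintype.card G : ℂ) * v j‖ := by simp
      _ ≤ ∑ ψ : AddChar G ℂ, ‖(starRingEnd ℂ) (ψ j) * (∑ k, ψ k * v k)‖ := by
        rw [← key]; exact norm_sum_le _ _
      _ = _ := by simp
  have h2 := Real.rpow_arith_mean_le_arith_mean_rpow Finset.univ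
    (fun _ : AddChar G ℂ => (Fintype.card G : ℝ)⁻¹) (fun ψ => ‖∑ k, ψ k * v k‖)
    (fun _ _ => by positivity) (by simp [AddChar.card_eq, hN.ne']) (fun _ _ => norm_nonneg _) hp
  rw [← Finset.mul_sum (s := Finset.univ) (f := fun ψ : AddChar G ℂ => ‖∑ k, ψ k * v k‖ ^ p)] at h2
  rw [← le_inv_mul_iff₀ hN]
  exact (Real.rpow_le_rpow (norm_nonneg _) h1 (by linarith)).trans h2

theorem card_le_of_forall_mem_Ioo (s : Finset ℕ) (a b : ℝ) (hab : a ≤ b)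
    (hs : ∀ k ∈ s, a < k ∧ (k : ℝ) < b) : (s.card : ℝ) ≤ b - a + 1 := by
  have hsub : s.map Nat.castEmbedding ⊆ Finset.Icc (⌊a⌋ + 1) (⌈b⌉ - 1) := by
    intro z hz
    obtain ⟨k, hk, rfl⟩ := Finset.mem_map.1 hz
    obtain ⟨h1, h2⟩ := hs k hk
    rw [Finset.mem_Icc]
    constructor
    · have : ⌊a⌋ < (k : ℤ) := Int.floor_lt.2 (by exact_mod_cast h1)
      simpa using this
    · have : (k : ℤ) < ⌈b⌉ := Int.lt_ceil.2 (by exact_mod_cast h2)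
      simp only [Nat.castEmbedding_apply]
      omega
  have hcard := Finset.card_le_card hsub
  rw [Finset.card_map, Int.card_Icc] at hcard
  have h0 : (⌈b⌉ : ℝ) < b + 1 := Int.ceil_lt_add_one b
  have h1 : a - 1 < ⌊a⌋ := Int.sub_one_lt_floor a
  rcases le_total 0 (⌈b⌉ - 1 + 1 - (⌊a⌋ + 1)) with h | h
  · have : (s.card : ℤ) ≤ ⌈b⌉ - 1 + 1 - (⌊a⌋ + 1) := by omega
    have : (s.card : ℝ) ≤ ⌈b⌉ - 1 + 1 - (⌊a⌋ + 1) := by exact_mod_cast this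
    linarith
  · have : s.card = 0 := by omega
    rw [this]; push_cast; linarith

theorem exists_measure_lattice (m : ℕ) (hm : 0 < m) (β : ℝ) (hβ : 0 < β) (hβ1 : β ≤ 1) :
    ∃ ν : Measure ℝ, IsProbabilityMeasure ν ∧
      (∀ x r : ℝ, 0 < r → ν (Metric.ball x r) ≤ ENNReal.ofReal (8 * r ^ β)) ∧
      ∀ᵐ y : ℝ ∂ν, ∃ k : Fin m, 0 ≤ y - (k : ℕ) / m ∧ y - (k : ℕ) / m ≤ (m : ℝ) ^ (-1 / β) := by
  set δ : ℝ := (m : ℝ) ^ (-1 / β) with hδ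
  have hmR : (0 : ℝ) < m := by exact_mod_cast hm
  have hm1 : (1 : ℝ) ≤ m := by exact_mod_cast hm
  have hδ0 : 0 < δ := Real.rpow_pos_of_pos hmR _
  have hδm : δ ≤ 1 / m := by
    rw [one_div, ← Real.rpow_neg_one]
    refine Real.rpow_le_rpow_of_exponent_le hm1 ?_
    rw [div_le_iff₀ hβ]; linarith
  have hδβ : δ ^ β = 1 / m := by
    rw [hδ, ← Real.rpow_mul hmR.le, div_mul_cancel₀ _ hβ.ne', Real.rpow_neg_one, one_div]
  set I : Fin m → Set ℝ := fun k => Set.Icc ((k : ℕ) / m : ℝ) ((k : ℕ) / m + δ) with hI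
  set ν : Measure ℝ := ∑ k : Fin m, ENNReal.ofReal (1 / (m * δ)) • volume.restrict (I k) with hν
  have happ : ∀ s : Set ℝ, MeasurableSet s →
      ν s = ∑ k : Fin m, ENNReal.ofReal (1 / (m * δ)) * volume (s ∩ I k) := by
    intro s hs
    rw [hν, Measure.coe_finsetSum, Finset.sum_apply]
    refine Finset.sum_congr rfl fun k _ => ?_
    rw [Measure.smul_apply, Measure.restrict_apply hs, smul_eq_mul]
  have hprob : IsProbabilityMeasure ν := by
    refine ⟨?_⟩
    rw [happ _ MeasurableSet.univ]
    simp only [Set.univ_inter, hI, Real.volume_Icc, add_sub_cancel_left]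
    rw [← ENNReal.ofReal_mul (by positivity), Finset.sum_const, Finset.card_univ, Fintype.card_fin,
      nsmul_eq_mul, ← ENNReal.ofReal_natCast, ← ENNReal.ofReal_mul hmR.le]
    rw [← ENNReal.ofReal_one]; congr 1; field_simp
  refine ⟨ν, hprob, ?_, ?_⟩
  · intro x r hr
    rcases lt_or_ge 1 r with hr1 | hr1
    · refine prob_le_one.trans ?_
      rw [← ENNReal.ofReal_one]
      refine ENNReal.ofReal_le_ofReal ?_
      have := Real.one_le_rpow hr1.le hβ.le
      linarith
    have hrβ : r ≤ r ^ β := by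
      simpa using Real.rpow_le_rpow_of_exponent_ge hr hr1 hβ1
    have hrβ0 : 0 < r ^ β := Real.rpow_pos_of_pos hr _
    obtain ⟨τ, hτ0, hτm, hτr, hτ⟩ : ∃ τ : ℝ, 0 ≤ τ ∧ τ ≤ 2 / m ∧ τ ≤ 2 * r ^ β ∧
        ∀ k, ENNReal.ofReal (1 / (m * δ)) * volume (Metric.ball x r ∩ I k) ≤ ENNReal.ofReal τ := by
      rcases le_or_gt δ r with h | h
      · refine ⟨1 / m, by positivity, by gcongr; norm_num, ?_, fun k => ?_⟩
        · rw [← hδβ]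
          have := Real.rpow_le_rpow hδ0.le h hβ.le
          linarith
        · calc _ ≤ ENNReal.ofReal (1 / (m * δ)) * volume (I k) := by
                gcongr; exact Set.inter_subset_right
            _ = ENNReal.ofReal (1 / m) := by
                simp only [hI, Real.volume_Icc, add_sub_cancel_left]
                rw [← ENNReal.ofReal_mul (by positivity)]
                congr 1; field_simp
      · refine ⟨1 / (m * δ) * (2 * r), by positivity, ?_, ?_, fun k => ?_⟩
        · rw [div_mul_eq_mul_div, div_le_div_iff₀ (by positivity) hmR]
          nlinarith
        · have h1 : 1 / (m * δ) = δ ^ (β - 1) := by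
            rw [Real.rpow_sub_one hδ0.ne', hδβ]; field_simp
          have h2 : δ ^ (β - 1) ≤ r ^ (β - 1) :=
            Real.rpow_le_rpow_of_nonpos hr h.le (by linarith)
          rw [h1]
          calc δ ^ (β - 1) * (2 * r) ≤ r ^ (β - 1) * (2 * r) := by gcongr
            _ = 2 * r ^ β := by rw [Real.rpow_sub_one hr.ne']; field_simp
        · rw [ENNReal.ofReal_mul (by positivity), ← Real.volume_ball x]
          gcongr; exact Set.inter_subset_left
    rw [happ _ measurableSet_ball]
    classical
    set S : Finset (Fin m) := Finset.univ.filter fun k => (Metric.ball x r ∩ I k).Nonempty with hS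
    have hcard : (S.card : ℝ) ≤ 2 * r * m + 2 := by
      have := card_le_of_forall_mem_Ioo (S.map Fin.valEmbedding) (m * (x - r - δ)) (m * (x + r))
        (by gcongr; linarith) ?_
      · rw [Finset.card_map] at this
        have h3 : m * δ ≤ 1 := by rw [mul_comm]; exact (le_div_iff₀ hmR).1 hδm
        nlinarith
      · intro k hk
        obtain ⟨k, hkS, rfl⟩ := Finset.mem_map.1 hk
        obtain ⟨y, hy, hy1, hy2⟩ := (Finset.mem_filter.1 hkS).2
        rw [Metric.mem_ball, Real.dist_eq, abs_lt] at hy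
        simp only [Fin.valEmbedding_apply]
        constructor
        · have : x - r - δ < (k : ℕ) / m := by linarith
          rw [lt_div_iff₀ hmR] at this; linarith
        · have : (k : ℕ) / m < x + r := by linarith
          rw [div_lt_iff₀ hmR] at this; linarith
    have hsum : ∑ k : Fin m, ENNReal.ofReal (1 / (m * δ)) * volume (Metric.ball x r ∩ I k)
        ≤ ∑ k ∈ S, ENNReal.ofReal τ := by
      rw [← Finset.sum_subset (Finset.subset_univ S)]
      · exact Finset.sum_le_sum fun k _ => hτ k
      · intro k _ hk
        have : Metric.ball x r ∩ I k = ∅ := by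
          rw [← Set.not_nonempty_iff_eq_empty]
          intro h; exact hk (Finset.mem_filter.2 ⟨Finset.mem_univ _, h⟩)
        simp [this]
    refine hsum.trans ?_
    rw [Finset.sum_const, nsmul_eq_mul, ← ENNReal.ofReal_natCast,
      ← ENNReal.ofReal_mul (by positivity)]
    refine ENNReal.ofReal_le_ofReal ?_
    calc (S.card : ℝ) * τ ≤ (2 * r * m + 2) * τ := by gcongr
      _ = 2 * r * m * τ + 2 * τ := by ring
      _ ≤ 2 * r * m * (2 / m) + 2 * (2 * r ^ β) := by gcongr
      _ = 4 * r + 4 * r ^ β := by field_simp; ring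
      _ ≤ 8 * r ^ β := by linarith
  · have hmeas : MeasurableSet (⋃ k, I k) := MeasurableSet.iUnion fun k => measurableSet_Icc
    have : ν (⋃ k, I k)ᶜ = 0 := by
      rw [happ _ hmeas.compl]
      refine Finset.sum_eq_zero fun k _ => ?_
      have : (⋃ k, I k)ᶜ ∩ I k = ∅ := by
        rw [← Set.disjoint_iff_inter_eq_empty, Set.disjoint_compl_left_iff_subset]
        exact Set.subset_iUnion I k
      rw [this, measure_empty, mul_zero]
    filter_upwards [mem_ae_iff.2 this] with y hy
    obtain ⟨k, hk1, hk2⟩ := Set.mem_iUnion.1 hy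
    exact ⟨k, by linarith, by linarith⟩

theorem norm_le_sum_abs {n : ℕ} (x : E n) : ‖x‖ ≤ ∑ i, |x i| := by
  rw [EuclideanSpace.norm_eq]
  refine Real.sqrt_le_iff.2 ⟨Finset.sum_nonneg fun _ _ => abs_nonneg _, ?_⟩
  simp only [Real.norm_eq_abs]
  exact Finset.sum_sq_le_sq_sum_of_nonneg fun _ _ => abs_nonneg _

theorem abs_apply_le_norm {n : ℕ} (x : E n) (i : Fin n) : |x i| ≤ ‖x‖ := by
  simpa using PiLp.norm_apply_le x i

theorem exists_measure_product {n : ℕ} (hn : 0 < n) (m : Fin n → ℕ) (hm : ∀ i, 0 < m i)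
    (β : Fin n → ℝ) (hβ : ∀ i, 0 < β i) (hβ1 : ∀ i, β i ≤ 1) :
    ∃ μ : Measure (E n), IsProbabilityMeasure μ ∧ μ (Metric.ball (0 : E n) 1)ᶜ = 0 ∧
      frostman μ (∑ i, β i) ≤ ENNReal.ofReal (8 ^ n * (4 * n) ^ (∑ i, β i)) ∧
      ∀ᵐ x : E n ∂μ, ∃ k : ∀ i, Fin (m i), ∀ i,
        |x i - (k i : ℕ) / m i / (4 * n)| ≤ (m i : ℝ) ^ (-1 / β i) / (4 * n) := by
  choose ν hν hball hae using fun i => exists_measure_lattice (m i) (hm i) (β i) (hβ i) (hβ1 i)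
  have hnR : (0 : ℝ) < n := by exact_mod_cast hn
  have hmR : ∀ i, (1 : ℝ) ≤ m i := fun i => by exact_mod_cast hm i
  set D : (Fin n → ℝ) → E n := fun y => WithLp.toLp 2 (fun i => y i / (4 * n)) with hD
  have hDm : Measurable D := by
    refine (PiLp.continuous_toLp 2 _).measurable.comp ?_
    exact measurable_pi_iff.2 fun i => (measurable_pi_apply i).div_const _
  have hae' : ∀ᵐ y : Fin n → ℝ ∂(Measure.pi ν), ∀ i, ∃ k : Fin (m i),
      0 ≤ y i - (k : ℕ) / m i ∧ y i - (k : ℕ) / m i ≤ (m i : ℝ) ^ (-1 / β i) := by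
    rw [ae_all_iff]
    exact fun i => (Measure.quasiMeasurePreserving_eval ν i).ae (hae i)
  refine ⟨(Measure.pi ν).map D, Measure.isProbabilityMeasure_map hDm.aemeasurable, ?_, ?_, ?_⟩
  · rw [Measure.map_apply hDm measurableSet_ball.compl]
    refine measure_mono_null ?_ (ae_iff.1 hae')
    intro y hy hcon
    refine hy ?_
    rw [Metric.mem_ball, dist_zero_right]
    refine (norm_le_sum_abs _).trans_lt ?_
    have : ∀ i, |D y i| ≤ 1 / (2 * n) := by
      intro i
      obtain ⟨k, h1, h2⟩ := hcon i
      have hk0 : (0 : ℝ) ≤ (k : ℕ) / m i := by positivity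
      have hk1 : ((k : ℕ) : ℝ) / m i ≤ 1 := by
        rw [div_le_one (by linarith [hmR i])]
        exact_mod_cast k.2.le
      have hδ1 : (m i : ℝ) ^ (-1 / β i) ≤ 1 :=
        Real.rpow_le_one_of_one_le_of_nonpos (hmR i)
          (div_nonpos_of_nonpos_of_nonneg (by norm_num) (hβ i).le)
      have hy0 : 0 ≤ y i := by linarith
      simp only [hD]
      rw [abs_of_nonneg (by positivity), div_le_div_iff₀ (by positivity) (by positivity)]
      nlinarith
    calc ∑ i, |D y i| ≤ ∑ _i : Fin n, 1 / (2 * (n : ℝ)) := Finset.sum_le_sum fun i _ => this i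
      _ < 1 := by
        simp only [Finset.sum_const, Finset.card_univ, Fintype.card_fin, nsmul_eq_mul]
        field_simp; norm_num
  · refine iSup_le fun x => iSup_le fun r => iSup_le fun hr => ?_
    have hsub : D ⁻¹' Metric.ball x r ⊆
        Set.univ.pi fun i => Metric.ball (4 * n * x i) (4 * n * r) := by
      intro y hy i _
      have h1 : ‖D y - x‖ < r := by simpa [dist_eq_norm] using hy
      have h2 := (abs_apply_le_norm (D y - x) i).trans_lt h1
      have h3 : y i - 4 * n * x i = 4 * n * ((D y - x) i) := by
        simp only [hD, PiLp.sub_apply]; field_simp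
      rw [Metric.mem_ball, Real.dist_eq, h3, abs_mul, abs_of_pos (by positivity)]
      gcongr
    rw [Measure.map_apply hDm measurableSet_ball]
    refine ENNReal.div_le_of_le_mul ((measure_mono hsub).trans ?_)
    rw [Measure.pi_pi, ← ENNReal.ofReal_mul (by positivity)]
    refine (Finset.prod_le_prod' fun i _ => hball i _ _ (by positivity)).trans ?_
    rw [← ENNReal.ofReal_prod_of_nonneg fun i _ => by positivity]
    refine ENNReal.ofReal_le_ofReal (le_of_eq ?_)
    rw [Finset.prod_mul_distrib, Finset.prod_const, Finset.card_univ, Fintype.card_fin,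
      ← Real.rpow_sum_of_pos (by positivity), Real.mul_rpow (by positivity) hr.le, mul_assoc]
  · refine (ae_map_iff hDm.aemeasurable ?_).2 ?_
    · simp only [Set.ofPred_exists, Set.ofPred_forall]
      refine MeasurableSet.iUnion fun k => MeasurableSet.iInter fun i => ?_
      refine IsClosed.measurableSet (isClosed_le ?_ continuous_const)
      fun_prop
    · filter_upwards [hae'] with y hy
      choose k hk using hy
      refine ⟨k, fun i => ?_⟩
      have : D y i - (k i : ℕ) / m i / (4 * n) = (y i - (k i : ℕ) / m i) / (4 * n) := by
        simp only [hD]; ring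
      rw [this, abs_div, abs_of_nonneg (hk i).1, abs_of_pos (by positivity)]
      gcongr
      exact (hk i).2

theorem exists_schwartzMap_FT_eq {n : ℕ} (g : E n → ℂ) (hg : ContDiff ℝ (⊤ : ℕ∞) g)
    (hg' : HasCompactSupport g) : ∃ f : SchwartzMap (E n) ℂ, FT (⇑f) = g := by
  set G : SchwartzMap (E n) ℂ := hg'.toSchwartzMap hg with hG
  refine ⟨FourierTransformInv.fourierInv G, ?_⟩
  have h : FourierTransform.fourier (FourierTransformInv.fourierInv G) = G :=
    FourierTransform.fourier_fourierInv_eq G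
  have h2 := congrArg (fun F : SchwartzMap (E n) ℂ => (F : E n → ℂ)) h
  simp only [SchwartzMap.fourier_coe] at h2
  funext ξ
  have h3 := congrFun h2 ξ
  rw [Real.fourier_eq'] at h3
  exact h3

/-- A smooth bump adapted to the box of centre `ξ₀` and sides comparable to `1 / δ i`. -/
def packet {n : ℕ} (φ : ContDiffBump (0 : ℝ)) (δ : Fin n → ℝ) (ξ₀ ξ : E n) : ℝ :=
  ∏ i, φ (δ i * (ξ i - ξ₀ i))

section Packet

variable {n : ℕ} (φ : ContDiffBump (0 : ℝ)) (δ : Fin n → ℝ) (ξ₀ : E n)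

theorem packet_nonneg (ξ : E n) : 0 ≤ packet φ δ ξ₀ ξ := Finset.prod_nonneg fun _ _ => φ.nonneg

theorem packet_le_one (ξ : E n) : packet φ δ ξ₀ ξ ≤ 1 :=
  Finset.prod_le_one (fun _ _ => φ.nonneg) fun _ _ => φ.le_one

theorem contDiff_packet : ContDiff ℝ (⊤ : ℕ∞) (packet φ δ ξ₀) := by
  unfold packet
  refine contDiff_prod fun i _ => φ.contDiff.comp ?_
  fun_prop

theorem abs_le_of_packet_ne_zero {ξ : E n} (h : packet φ δ ξ₀ ξ ≠ 0) (i : Fin n) :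
    |δ i * (ξ i - ξ₀ i)| ≤ φ.rOut := by
  have := Finset.prod_ne_zero_iff.1 h i (Finset.mem_univ i)
  by_contra! hcon
  refine this (φ.zero_of_le_dist ?_)
  simpa using hcon.le

theorem hasCompactSupport_packet (hδ : ∀ i, 0 < δ i) : HasCompactSupport (packet φ δ ξ₀) := by
  refine HasCompactSupport.intro (isCompact_closedBall ξ₀ (∑ i, φ.rOut / δ i)) fun ξ hξ => ?_
  by_contra hne
  refine hξ ?_
  rw [Metric.mem_closedBall, dist_eq_norm]
  refine (norm_le_sum_abs _).trans (Finset.sum_le_sum fun i _ => ?_)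
  have := abs_le_of_packet_ne_zero φ δ ξ₀ hne i
  rw [abs_mul, abs_of_pos (hδ i)] at this
  rw [le_div_iff₀ (hδ i), PiLp.sub_apply]
  linarith

theorem integral_packet (hδ : ∀ i, 0 < δ i) :
    ∫ ξ, packet φ δ ξ₀ ξ = (∏ i, (δ i)⁻¹) * (∫ y, φ y) ^ n := by
  unfold packet
  rw [← (PiLp.volume_preserving_toLp (Fin n)).integral_comp
    (MeasurableEquiv.toLp 2 (Fin n → ℝ)).measurableEmbedding]
  rw [integral_fintype_prod_volume_eq_prod (f := fun i (v : ℝ) => φ (δ i * (v - ξ₀ i)))]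
  have : ∀ i, ∫ v : ℝ, φ (δ i * (v - ξ₀ i)) = (δ i)⁻¹ * ∫ y, φ y := by
    intro i
    rw [integral_sub_right_eq_self (fun v : ℝ => φ (δ i * v)),
      Measure.integral_comp_mul_left (fun v => φ v), smul_eq_mul,
      abs_of_pos (inv_pos.2 (hδ i))]
  simp only [this, Finset.prod_mul_distrib, Finset.prod_const, Finset.card_univ, Fintype.card_fin]

end Packet

/-- The half-wave extension of a frequency profile `g`. -/
def wave {n : ℕ} (g : E n → ℂ) (t : ℝ) (x : E n) : ℂ :=
  ∫ ξ : E n, Complex.exp (((2 * π * (⟪x, ξ⟫ + t * ‖ξ‖) : ℝ) : ℂ) * Complex.I) * g ξ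

theorem norm_wave_le {n : ℕ} (g : E n → ℂ) (t : ℝ) (x : E n) : ‖wave g t x‖ ≤ ∫ ξ, ‖g ξ‖ := by
  refine (norm_integral_le_integral_norm _).trans (le_of_eq ?_)
  simp only [norm_mul, Complex.norm_exp_ofReal_mul_I, one_mul]

theorem integrable_wave {n : ℕ} {g : E n → ℂ} (hg : Integrable g) (t : ℝ) (x : E n) :
    Integrable fun ξ : E n =>
      Complex.exp (((2 * π * (⟪x, ξ⟫ + t * ‖ξ‖) : ℝ) : ℂ) * Complex.I) * g ξ := by
  refine hg.norm.mono' ?_ (Filter.Eventually.of_forall fun ξ => ?_)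
  · refine AEStronglyMeasurable.mul (Continuous.aestronglyMeasurable ?_) hg.aestronglyMeasurable
    fun_prop
  · simp only [norm_mul, Complex.norm_exp_ofReal_mul_I, one_mul, le_refl]

theorem continuous_wave {n : ℕ} {g : E n → ℂ} (hg : Integrable g) :
    Continuous fun z : ℝ × E n => wave g z.1 z.2 := by
  refine continuous_of_dominated (bound := fun ξ => ‖g ξ‖)
    (fun z => (integrable_wave hg z.1 z.2).aestronglyMeasurable)
    (fun z => Filter.Eventually.of_forall fun ξ => ?_) hg.norm
    (Filter.Eventually.of_forall fun ξ => ?_)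
  · simp only [norm_mul, Complex.norm_exp_ofReal_mul_I, one_mul, le_refl]
  · fun_prop

/-- Where the phase is almost constant on the support of `b ≥ 0`, there is no cancellation. -/
theorem half_integral_le_norm_wave {n : ℕ} {b : E n → ℝ} (hb : Integrable b) (hb0 : ∀ ξ, 0 ≤ b ξ)
    (t : ℝ) (x : E n) (θ : ℝ)
    (h : ∀ ξ, b ξ ≠ 0 → |2 * π * (⟪x, ξ⟫ + t * ‖ξ‖) - θ| ≤ 1) :
    1 / 2 * ∫ ξ, b ξ ≤ ‖wave (fun ξ => (b ξ : ℂ)) t x‖ := by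
  have hrot : Complex.exp (((-θ : ℝ) : ℂ) * Complex.I) * wave (fun ξ => (b ξ : ℂ)) t x
      = ∫ ξ, Complex.exp (((2 * π * (⟪x, ξ⟫ + t * ‖ξ‖) - θ : ℝ) : ℂ) * Complex.I) * (b ξ : ℂ) := by
    rw [wave, ← integral_const_mul]
    congr 1
    funext ξ
    rw [← mul_assoc, ← Complex.exp_add]
    congr 2
    push_cast
    ring
  have hint : Integrable fun ξ =>
      Complex.exp (((2 * π * (⟪x, ξ⟫ + t * ‖ξ‖) - θ : ℝ) : ℂ) * Complex.I) * (b ξ : ℂ) := by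
    refine hb.norm.mono' ?_ (Filter.Eventually.of_forall fun ξ => ?_)
    · refine AEStronglyMeasurable.mul (Continuous.aestronglyMeasurable ?_)
        hb.ofReal.aestronglyMeasurable
      fun_prop
    · rw [norm_mul, Complex.norm_exp_ofReal_mul_I, one_mul, Complex.norm_real]
  have hnorm : ‖wave (fun ξ => (b ξ : ℂ)) t x‖
      = ‖Complex.exp (((-θ : ℝ) : ℂ) * Complex.I) * wave (fun ξ => (b ξ : ℂ)) t x‖ := by
    rw [norm_mul, Complex.norm_exp_ofReal_mul_I, one_mul]
  rw [hnorm, hrot]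
  refine le_trans ?_ (Complex.re_le_norm _)
  rw [← Complex.reCLM_apply, ← ContinuousLinearMap.integral_comp_comm _ hint, ← integral_const_mul]
  refine integral_mono (hb.const_mul _) (Complex.reCLM.integrable_comp hint) fun ξ => ?_
  simp only [Complex.reCLM_apply, Complex.re_mul_ofReal, Complex.exp_ofReal_mul_I_re]
  by_cases hξ : b ξ = 0
  · simp [hξ]
  refine mul_le_mul_of_nonneg_right ?_ (hb0 ξ)
  have h1 := h ξ hξ
  rw [← Real.cos_abs]
  refine le_trans ?_ (Real.one_sub_sq_div_two_le_cos)
  have : |2 * π * (⟪x, ξ⟫ + t * ‖ξ‖) - θ| ^ 2 ≤ 1 := pow_le_one₀ (abs_nonneg _) h1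
  linarith

theorem wave_modulated_sum {n : ℕ} {G : Type*} [Fintype G] {b : E n → ℂ} (hb : Integrable b)
    (c : G → ℂ) (X : G → E n) (t : ℝ) (x : E n) :
    wave (fun ξ => ∑ k, c k * (Complex.exp (((-2 * π * ⟪X k, ξ⟫ : ℝ) : ℂ) * Complex.I) * b ξ)) t x
      = ∑ k, c k * wave b t (x - X k) := by
  simp only [wave]
  simp_rw [← integral_const_mul]
  rw [← integral_finsetSum _ fun k _ => (integrable_wave hb t (x - X k)).const_mul _]
  congr 1
  funext ξ
  rw [Finset.mul_sum]
  refine Finset.sum_congr rfl fun k _ => ?_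
  have : Complex.exp (((2 * π * (⟪x - X k, ξ⟫ + t * ‖ξ‖) : ℝ) : ℂ) * Complex.I)
      = Complex.exp (((2 * π * (⟪x, ξ⟫ + t * ‖ξ‖) : ℝ) : ℂ) * Complex.I) *
        Complex.exp (((-2 * π * ⟪X k, ξ⟫ : ℝ) : ℂ) * Complex.I) := by
    rw [← Complex.exp_add, inner_sub_left]
    congr 1
    push_cast
    ring
  rw [this]
  ring

theorem continuous_integral_of_bounded {Y : Type*} [TopologicalSpace Y] [MeasurableSpace Y]
    [OpensMeasurableSpace Y] (μ : Measure Y) [IsFiniteMeasure μ] {h : ℝ → Y → ℝ}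
    (hh : Continuous fun z : ℝ × Y => h z.1 z.2) {M : ℝ} (hM : ∀ t x, ‖h t x‖ ≤ M) :
    Continuous fun t => ∫ x, h t x ∂μ := by
  have h1 : ∀ t, Continuous fun x => h t x := fun t => hh.comp (Continuous.prodMk_right t)
  have h2 : ∀ x, Continuous fun t => h t x := fun x => hh.comp (Continuous.prodMk_left x)
  exact continuous_of_dominated (fun t => (h1 t).aestronglyMeasurable)
    (fun t => Filter.Eventually.of_forall fun x => hM t x) (integrable_const M)
    (Filter.Eventually.of_forall h2)

/-- Averaging the Strichartz estimate over all character sums of translates of one wave packet. -/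
theorem strichartz_averaged {n : ℕ} {p α s C K R T : ℝ} (hp₁ : 1 ≤ p) (hp₂ : p ≤ 2) (hs : 0 ≤ s)
    (hC : 0 < C) (hK : 0 ≤ K) (hR : 1 ≤ R) (hT0 : 0 ≤ T) (hT1 : T ≤ 1)
    (H : ∀ (f : SchwartzMap (E n) ℂ) (μ : Measure (E n)), IsFiniteMeasure μ →
        μ (Metric.ball (0 : E n) 1)ᶜ = 0 → frostman μ α < ⊤ →
        (∫ t in (0:ℝ)..1, ∫ x, ‖halfWave (⇑f) t x‖ ^ p ∂μ) ^ (1/p) ≤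
          C * (frostman μ α).toReal ^ (1/p) * sobolevNorm (⇑f) s)
    (μ : Measure (E n)) [IsProbabilityMeasure μ] (hμ : μ (Metric.ball (0 : E n) 1)ᶜ = 0)
    (hfr : frostman μ α ≤ ENNReal.ofReal K)
    {G : Type*} [AddCommGroup G] [Fintype G] (X : G → E n)
    (b : E n → ℝ) (hbs : ContDiff ℝ (⊤ : ℕ∞) b) (hbc : HasCompactSupport b)
    (hb0 : ∀ ξ, 0 ≤ b ξ) (hb1 : ∀ ξ, b ξ ≤ 1) (hbR : ∀ ξ, b ξ ≠ 0 → ‖ξ‖ ≤ 2 * R)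
    (hlow : ∀ᵐ x ∂μ, ∃ k, ∀ t ∈ Set.Icc 0 T,
      1 / 2 * ∫ ξ, b ξ ≤ ‖wave (fun ξ => (b ξ : ℂ)) t (x - X k)‖) :
    T * (1 / 2 * ∫ ξ, b ξ) ^ p ≤
      C ^ p * K * (Fintype.card G * ((5 * R ^ 2) ^ s * ∫ ξ, b ξ)) ^ (p / 2) := by
  have hp0 : 0 < p := by linarith
  have hN : (0 : ℝ) < Fintype.card G := by exact_mod_cast Fintype.card_pos_iff.2 ⟨0⟩
  have hbi : Integrable b := hbs.continuous.integrable_of_hasCompactSupport hbc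
  have hbi0 : 0 ≤ ∫ ξ, b ξ := integral_nonneg hb0
  set v : G → E n → ℂ := fun k ξ =>
    Complex.exp (((-2 * π * ⟪X k, ξ⟫ : ℝ) : ℂ) * Complex.I) * (b ξ : ℂ) with hv
  have hvn : ∀ k ξ, ‖v k ξ‖ = b ξ := fun k ξ => by
    rw [hv]
    simp only [norm_mul, Complex.norm_exp_ofReal_mul_I, one_mul, Complex.norm_real,
      Real.norm_eq_abs, abs_of_nonneg (hb0 ξ)]
  set g : AddChar G ℂ → E n → ℂ := fun ψ ξ => ∑ k, ψ k * v k ξ with hg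
  have hgs : ∀ ψ, ContDiff ℝ (⊤ : ℕ∞) (g ψ) := fun ψ => by
    refine ContDiff.sum fun k _ => contDiff_const.mul (ContDiff.mul ?_ ?_)
    · refine ContDiff.cexp (ContDiff.mul ?_ contDiff_const)
      refine Complex.ofRealCLM.contDiff.comp ?_
      exact contDiff_const.mul (contDiff_const.inner ℝ contDiff_id)
    · exact Complex.ofRealCLM.contDiff.comp hbs
  have hgc : ∀ ψ, HasCompactSupport (g ψ) := fun ψ => by
    refine hbc.mono fun ξ hξ hb => hξ ?_
    simp [hg, hv, hb]
  have hgi : ∀ ψ, Integrable (g ψ) := fun ψ =>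
    (hgs ψ).continuous.integrable_of_hasCompactSupport (hgc ψ)
  have hwave : ∀ ψ t x, wave (g ψ) t x
      = ∑ k, ψ k * wave (fun ξ => (b ξ : ℂ)) t (x - X k) := fun ψ t x =>
    wave_modulated_sum hbi.ofReal (fun k => ψ k) X t x
  set S : AddChar G ℂ → ℝ := fun ψ => ∫ ξ : E n, (1 + ‖ξ‖ ^ 2) ^ s * ‖g ψ ξ‖ ^ 2 with hS
  have hS0 : ∀ ψ, 0 ≤ S ψ := fun ψ => integral_nonneg fun ξ => by positivity
  set F : AddChar G ℂ → ℝ → ℝ := fun ψ t => ∫ x, ‖wave (g ψ) t x‖ ^ p ∂μ with hF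
  have hF0 : ∀ ψ t, 0 ≤ F ψ t := fun ψ t => integral_nonneg fun x => by positivity
  have hcont : ∀ ψ, Continuous fun z : ℝ × E n => ‖wave (g ψ) z.1 z.2‖ ^ p := fun ψ =>
    (continuous_wave (hgi ψ)).norm.rpow_const fun _ => Or.inr hp0.le
  have hbound : ∀ ψ t x, ‖‖wave (g ψ) t x‖ ^ p‖ ≤ (∫ ξ, ‖g ψ ξ‖) ^ p := fun ψ t x => by
    rw [Real.norm_of_nonneg (by positivity)]
    exact Real.rpow_le_rpow (norm_nonneg _) (norm_wave_le _ _ _) hp0.le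
  have hint : ∀ ψ t, Integrable (fun x => ‖wave (g ψ) t x‖ ^ p) μ := fun ψ t =>
    (integrable_const ((∫ ξ, ‖g ψ ξ‖) ^ p)).mono'
      ((hcont ψ).comp (Continuous.prodMk_right t)).aestronglyMeasurable
      (Filter.Eventually.of_forall fun x => hbound ψ t x)
  have hFc : ∀ ψ, Continuous (F ψ) := fun ψ =>
    continuous_integral_of_bounded μ (hcont ψ) (hbound ψ)
  have hest : ∀ ψ, ∫ t in (0:ℝ)..1, F ψ t ≤ C ^ p * K * S ψ ^ (p / 2) := fun ψ => by
    obtain ⟨f, hf⟩ := exists_schwartzMap_FT_eq (g ψ) (hgs ψ) (hgc ψ)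
    have h1 := H f μ inferInstance hμ (hfr.trans_lt ENNReal.ofReal_lt_top)
    have h2 : ∀ t x, halfWave (⇑f) t x = wave (g ψ) t x := fun t x => by
      simp only [halfWave, wave, hf]
    have h3 : sobolevNorm (⇑f) s = S ψ ^ (1 / 2 : ℝ) := by
      simp only [sobolevNorm, hf, hS]
    simp only [h2, h3] at h1
    have hA : 0 ≤ ∫ t in (0:ℝ)..1, F ψ t :=
      intervalIntegral.integral_nonneg zero_le_one fun t _ => hF0 ψ t
    have hfrK : (frostman μ α).toReal ≤ K := ENNReal.toReal_le_of_le_ofReal hK hfr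
    have h4 := Real.rpow_le_rpow (by positivity) h1 hp0.le
    rw [← Real.rpow_mul hA, one_div_mul_cancel hp0.ne', Real.rpow_one] at h4
    refine h4.trans ?_
    have hS' := hS0 ψ
    rw [Real.mul_rpow (by positivity) (by positivity), Real.mul_rpow hC.le (by positivity),
      ← Real.rpow_mul (by positivity), one_div_mul_cancel hp0.ne', Real.rpow_one,
      ← Real.rpow_mul hS', one_div_mul_eq_div]
    gcongr
  have hSsum : ∑ ψ, S ψ ≤ Fintype.card G * (Fintype.card G * ((5 * R ^ 2) ^ s * ∫ ξ, b ξ)) := by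
    have hwi : ∀ ψ, Integrable fun ξ : E n => (1 + ‖ξ‖ ^ 2) ^ s * ‖g ψ ξ‖ ^ 2 := fun ψ => by
      refine Continuous.integrable_of_hasCompactSupport ?_ ?_
      · refine Continuous.mul (Continuous.rpow_const (by fun_prop) fun _ => Or.inr hs) ?_
        exact (hgs ψ).continuous.norm.pow 2
      · refine (hgc ψ).mono fun ξ hξ h => hξ ?_
        simp [h]
    rw [← integral_finsetSum _ fun ψ _ => hwi ψ]
    rw [← integral_const_mul, ← integral_const_mul, ← integral_const_mul]
    refine integral_mono (integrable_finsetSum _ fun ψ _ => hwi ψ)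
      (((hbi.const_mul _).const_mul _).const_mul _) fun ξ => ?_
    simp only
    rw [← Finset.mul_sum, addChar_sum_norm_sq]
    simp only [hvn, Finset.sum_const, Finset.card_univ, nsmul_eq_mul]
    by_cases hξ : b ξ = 0
    · simp [hξ]
    have hle : (1 + ‖ξ‖ ^ 2) ^ s ≤ (5 * R ^ 2) ^ s := by
      refine Real.rpow_le_rpow (by positivity) ?_ hs
      have := hbR ξ hξ
      nlinarith [norm_nonneg ξ]
    have hb2 : b ξ ^ 2 ≤ b ξ := by nlinarith [hb0 ξ, hb1 ξ]
    have hb' := hb0 ξ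
    calc (1 + ‖ξ‖ ^ 2) ^ s * (Fintype.card G * (Fintype.card G * b ξ ^ 2))
        = Fintype.card G * (Fintype.card G * ((1 + ‖ξ‖ ^ 2) ^ s * b ξ ^ 2)) := by ring
      _ ≤ _ := by gcongr
  have hJ : ∑ ψ, S ψ ^ (p / 2) ≤
      Fintype.card G * (Fintype.card G * ((5 * R ^ 2) ^ s * ∫ ξ, b ξ)) ^ (p / 2) := by
    have h1 := Real.rpow_arith_mean_le_arith_mean_rpow Finset.univ
      (fun _ : AddChar G ℂ => (Fintype.card G : ℝ)⁻¹) (fun ψ => S ψ ^ (p / 2))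
      (fun _ _ => by positivity) (by simp [AddChar.card_eq, hN.ne'])
      (fun ψ _ => Real.rpow_nonneg (hS0 ψ) _) (p := 2 / p) (by rw [one_le_div hp0]; exact hp₂)
    simp only [← Finset.mul_sum] at h1
    have h2 : ∀ ψ, (S ψ ^ (p / 2)) ^ (2 / p) = S ψ := fun ψ => by
      rw [← Real.rpow_mul (hS0 ψ), div_mul_div_cancel₀ (by norm_num), div_self hp0.ne',
        Real.rpow_one]
    simp only [h2] at h1
    have hQ0 : 0 ≤ ∑ ψ, S ψ ^ (p / 2) :=
      Finset.sum_nonneg fun ψ _ => Real.rpow_nonneg (hS0 ψ) _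
    have h3 := h1.trans ((inv_mul_le_iff₀ hN).2 hSsum)
    have h4 := Real.rpow_le_rpow (by positivity) h3 (z := p / 2) (by positivity)
    rw [← Real.rpow_mul (by positivity), div_mul_div_cancel₀ hp0.ne', div_self (by norm_num),
      Real.rpow_one] at h4
    exact (inv_mul_le_iff₀ hN).1 h4
  have hlower : Fintype.card G * (T * (1 / 2 * ∫ ξ, b ξ) ^ p) ≤ ∑ ψ, ∫ t in (0:ℝ)..1, F ψ t := by
    have hc : Continuous fun t => ∑ ψ, F ψ t := continuous_finsetSum _ fun ψ _ => hFc ψ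
    rw [← intervalIntegral.integral_finsetSum fun ψ _ => (hFc ψ).intervalIntegrable _ _]
    have hsub : ∫ t in (0:ℝ)..T, ∑ ψ, F ψ t ≤ ∫ t in (0:ℝ)..1, ∑ ψ, F ψ t :=
      intervalIntegral.integral_mono_interval le_rfl hT0 hT1
        (Filter.Eventually.of_forall fun t => Finset.sum_nonneg fun ψ _ => hF0 ψ t)
        (hc.intervalIntegrable _ _)
    refine le_trans ?_ hsub
    have hconst : Fintype.card G * (T * (1 / 2 * ∫ ξ, b ξ) ^ p)
        = ∫ t in (0:ℝ)..T, Fintype.card G * (1 / 2 * ∫ ξ, b ξ) ^ p := by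
      rw [intervalIntegral.integral_const, smul_eq_mul]; ring
    rw [hconst]
    refine intervalIntegral.integral_mono_on hT0 intervalIntegrable_const
      (hc.intervalIntegrable _ _) fun t ht => ?_
    rw [← integral_finsetSum _ fun ψ _ => hint ψ t]
    have h1 : (Fintype.card G : ℝ) * (1 / 2 * ∫ ξ, b ξ) ^ p
        = ∫ _x, (Fintype.card G : ℝ) * (1 / 2 * ∫ ξ, b ξ) ^ p ∂μ := by simp
    rw [h1]
    refine integral_mono_ae (integrable_const _) (integrable_finsetSum _ fun ψ _ => hint ψ t) ?_
    filter_upwards [hlow] with x hx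
    obtain ⟨k, hk⟩ := hx
    simp only [hwave]
    refine le_trans ?_ (addChar_le_sum_norm_rpow
      (fun k => wave (fun ξ => (b ξ : ℂ)) t (x - X k)) hp₁ k)
    gcongr
    exact hk t ht
  have hfin : Fintype.card G * (T * (1 / 2 * ∫ ξ, b ξ) ^ p) ≤ Fintype.card G *
      (C ^ p * K * (Fintype.card G * ((5 * R ^ 2) ^ s * ∫ ξ, b ξ)) ^ (p / 2)) := by
    refine hlower.trans ((Finset.sum_le_sum fun ψ _ => hest ψ).trans ?_)
    rw [← Finset.mul_sum, mul_left_comm]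
    gcongr
  exact le_of_mul_le_mul_left hfin hN

theorem strichartz_box {n : ℕ} (hn : 0 < n) {p α s C : ℝ} (hp₁ : 1 ≤ p) (hp₂ : p ≤ 2)
    (hs : 0 ≤ s) (hC : 0 < C)
    (H : ∀ (f : SchwartzMap (E n) ℂ) (μ : Measure (E n)), IsFiniteMeasure μ →
        μ (Metric.ball (0 : E n) 1)ᶜ = 0 → frostman μ α < ⊤ →
        (∫ t in (0:ℝ)..1, ∫ x, ‖halfWave (⇑f) t x‖ ^ p ∂μ) ^ (1/p) ≤
          C * (frostman μ α).toReal ^ (1/p) * sobolevNorm (⇑f) s) :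
    ∃ C' : ℝ, ∀ (m : Fin n → ℕ) (β δ : Fin n → ℝ) (ξ₀ : E n) (R T : ℝ),
      (∀ i, 0 < m i) → (∀ i, 0 < β i) → (∀ i, β i ≤ 1) → ∑ i, β i = α →
      (∀ i, δ i = (m i : ℝ) ^ (-1 / β i)) → 1 ≤ R → 0 ≤ T → T ≤ 1 →
      (∀ ξ : E n, (∀ i, |δ i * (ξ i - ξ₀ i)| ≤ 1 / (20 * n)) →
        ‖ξ‖ ≤ 2 * R ∧ ∀ t ∈ Set.Icc 0 T, t * |‖ξ‖ - ‖ξ₀‖| ≤ 1 / 20) →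
      T * (∏ i, (δ i)⁻¹) ^ (p / 2) ≤ C' * ((∏ i, (m i : ℝ)) ^ (p / 2) * R ^ (s * p)) := by
  have hp0 : 0 < p := by linarith
  have hnR : (1 : ℝ) ≤ n := by exact_mod_cast hn
  let φ : ContDiffBump (0 : ℝ) := ⟨1 / (40 * n), 1 / (20 * n), by positivity, by gcongr; norm_num⟩
  have hκ : 0 < ∫ y, φ y := φ.integral_pos
  set κ : ℝ := ∫ y, φ y
  set K : ℝ := 8 ^ n * (4 * n) ^ α
  refine ⟨2 ^ p * (C ^ p * K * (5 ^ s) ^ (p / 2)) / (κ ^ n) ^ (p / 2), ?_⟩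
  intro m β δ ξ₀ R T hm hβ hβ1 hsum hδ hR hT0 hT1 hph
  have hδ0 : ∀ i, 0 < δ i := fun i => by
    rw [hδ]; exact Real.rpow_pos_of_pos (by exact_mod_cast hm i) _
  obtain ⟨μ, hμp, hμ, hfr, hae⟩ := exists_measure_product hn m hm β hβ hβ1
  rw [hsum] at hfr
  have : ∀ i, NeZero (m i) := fun i => ⟨(hm i).ne'⟩
  set X : (∀ i, Fin (m i)) → E n := fun k => WithLp.toLp 2 fun i => (k i : ℕ) / m i / (4 * n)
  have hint : ∫ ξ, packet φ δ ξ₀ ξ = (∏ i, (δ i)⁻¹) * κ ^ n := integral_packet φ δ ξ₀ hδ0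
  have hbs := contDiff_packet φ δ ξ₀
  have hbc := hasCompactSupport_packet φ δ ξ₀ hδ0
  have hbox : ∀ ξ, packet φ δ ξ₀ ξ ≠ 0 → ∀ i, |δ i * (ξ i - ξ₀ i)| ≤ 1 / (20 * n) :=
    fun ξ hξ i => abs_le_of_packet_ne_zero φ δ ξ₀ hξ i
  have key := strichartz_averaged (K := K) (R := R) (T := T) hp₁ hp₂ hs hC (by positivity) hR
    hT0 hT1 H μ hμ hfr X (packet φ δ ξ₀) hbs hbc (packet_nonneg φ δ ξ₀) (packet_le_one φ δ ξ₀)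
    (fun ξ hξ => (hph ξ (hbox ξ hξ)).1) ?_
  · rw [hint] at key
    have hcard : (Fintype.card (∀ i, Fin (m i)) : ℝ) = ∏ i, (m i : ℝ) := by simp
    rw [hcard] at key
    set P : ℝ := ∏ i, (δ i)⁻¹
    set N : ℝ := ∏ i, (m i : ℝ)
    have hP : 0 < P := Finset.prod_pos fun i _ => inv_pos.2 (hδ0 i)
    have hN : 0 ≤ N := Finset.prod_nonneg fun i _ => Nat.cast_nonneg _
    have hR0 : 0 < R := by linarith
    have hRs : ((R ^ 2) ^ s) ^ (p / 2) = R ^ (s * p) := by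
      rw [← Real.rpow_natCast, ← Real.rpow_mul hR0.le, ← Real.rpow_mul hR0.le]
      congr 1; push_cast; ring
    have hI : (P * κ ^ n) ^ p = (P * κ ^ n) ^ (p / 2) * (P * κ ^ n) ^ (p / 2) := by
      rw [← Real.rpow_add (by positivity)]; congr 1; ring
    have hI0 : 0 < (P * κ ^ n) ^ (p / 2) := by positivity
    have hleft : (1 / 2 * (P * κ ^ n)) ^ p
        = 1 / 2 ^ p * ((P * κ ^ n) ^ (p / 2) * (P * κ ^ n) ^ (p / 2)) := by
      rw [Real.mul_rpow (by norm_num) (by positivity), hI,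
        Real.div_rpow (by norm_num) (by norm_num), Real.one_rpow]
    have hright : (N * ((5 * R ^ 2) ^ s * (P * κ ^ n))) ^ (p / 2)
        = N ^ (p / 2) * ((5 ^ s) ^ (p / 2) * R ^ (s * p) * (P * κ ^ n) ^ (p / 2)) := by
      rw [Real.mul_rpow hN (by positivity), Real.mul_rpow (by positivity) (by positivity),
        Real.mul_rpow (x := 5) (by norm_num) (by positivity),
        Real.mul_rpow (x := 5 ^ s) (by positivity) (by positivity), hRs]
    rw [hleft, hright] at key
    have key2 : T * (P * κ ^ n) ^ (p / 2) * (P * κ ^ n) ^ (p / 2) ≤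
        2 ^ p * (C ^ p * K * (5 ^ s) ^ (p / 2)) * (N ^ (p / 2) * R ^ (s * p)) *
          (P * κ ^ n) ^ (p / 2) := by
      have h2 : (0 : ℝ) < 2 ^ p := by positivity
      calc T * (P * κ ^ n) ^ (p / 2) * (P * κ ^ n) ^ (p / 2)
          = 2 ^ p * (T * (1 / 2 ^ p * ((P * κ ^ n) ^ (p / 2) * (P * κ ^ n) ^ (p / 2)))) := by
            field_simp
        _ ≤ _ := mul_le_mul_of_nonneg_left key h2.le
        _ = _ := by ring
    have key3 := le_of_mul_le_mul_right key2 hI0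
    rw [Real.mul_rpow hP.le (by positivity), ← mul_assoc] at key3
    rw [div_mul_eq_mul_div, le_div_iff₀ (by positivity)]
    exact key3
  · filter_upwards [hae] with x hx
    obtain ⟨k, hk⟩ := hx
    refine ⟨k, fun t ht => ?_⟩
    refine half_integral_le_norm_wave (hbs.continuous.integrable_of_hasCompactSupport hbc)
      (packet_nonneg φ δ ξ₀) t (x - X k) (2 * π * (⟪x - X k, ξ₀⟫ + t * ‖ξ₀‖)) fun ξ hξ => ?_
    have h1 := (hph ξ (hbox ξ hξ)).2 t ht
    have h2 : |⟪x - X k, ξ - ξ₀⟫| ≤ 1 / 80 := by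
      rw [PiLp.inner_apply]
      refine (Finset.abs_sum_le_sum_abs _ _).trans ?_
      have hterm : ∀ i, |⟪(x - X k) i, (ξ - ξ₀) i⟫| ≤ 1 / (80 * n) := fun i => by
        have ha := hk i
        have hb := hbox ξ hξ i
        rw [← hδ] at ha
        rw [abs_mul, abs_of_pos (hδ0 i)] at hb
        have hc : ⟪(x - X k) i, (ξ - ξ₀) i⟫
            = (x i - (k i : ℕ) / m i / (4 * n)) * (ξ i - ξ₀ i) := by
          simp [X, mul_comm]
        rw [hc, abs_mul]
        calc |x i - (k i : ℕ) / m i / (4 * n)| * |ξ i - ξ₀ i|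
            ≤ δ i / (4 * n) * |ξ i - ξ₀ i| := by gcongr
          _ = δ i * |ξ i - ξ₀ i| / (4 * n) := by ring
          _ ≤ 1 / (20 * n) / (4 * n) := by gcongr
          _ = 1 / (80 * n) * (1 / n) := by field_simp; norm_num
          _ ≤ 1 / (80 * n) * 1 := by
            gcongr; rw [div_le_one (by positivity)]; exact hnR
          _ = 1 / (80 * n) := mul_one _
      refine (Finset.sum_le_sum fun i _ => hterm i).trans (le_of_eq ?_)
      simp only [Finset.sum_const, Finset.card_univ, Fintype.card_fin, nsmul_eq_mul]
      field_simp
    have h3 : 2 * π * (⟪x - X k, ξ⟫ + t * ‖ξ‖) - 2 * π * (⟪x - X k, ξ₀⟫ + t * ‖ξ₀‖)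
        = 2 * π * (⟪x - X k, ξ - ξ₀⟫ + t * (‖ξ‖ - ‖ξ₀‖)) := by
      rw [inner_sub_right]; ring
    rw [h3, abs_mul, abs_of_pos (by positivity)]
    have h4 : |⟪x - X k, ξ - ξ₀⟫ + t * (‖ξ‖ - ‖ξ₀‖)| ≤ 1 / 80 + 1 / 20 := by
      refine (abs_add_le _ _).trans (add_le_add h2 ?_)
      rwa [abs_mul, abs_of_nonneg ht.1]
    calc 2 * π * |⟪x - X k, ξ - ξ₀⟫ + t * (‖ξ‖ - ‖ξ₀‖)|
        ≤ 2 * 4 * (1 / 80 + 1 / 20) := by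
          gcongr
          exact Real.pi_le_four
      _ ≤ 1 := by norm_num

theorem exponent_le_of_forall_nat {a b C : ℝ}
    (h : ∀ M : ℕ, 0 < M → (M : ℝ) ^ a ≤ C * (M : ℝ) ^ b) : a ≤ b := by
  by_contra! hab
  have ht : Filter.Tendsto (fun M : ℕ => (M : ℝ) ^ (a - b)) Filter.atTop Filter.atTop :=
    (tendsto_rpow_atTop (sub_pos.2 hab)).comp tendsto_natCast_atTop_atTop
  obtain ⟨M, hM1, hM2⟩ := ((ht.eventually_gt_atTop C).and (Filter.eventually_gt_atTop 0)).exists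
  have hM0 : (0 : ℝ) < M := by exact_mod_cast hM2
  have := h M hM2
  rw [Real.rpow_sub hM0, lt_div_iff₀ (Real.rpow_pos_of_pos hM0 _)] at hM1
  linarith

/-- Many spherical waves focusing at time zero. -/
theorem le_of_strichartz_focusing {n : ℕ} (hn : 0 < n) {p α s C : ℝ} (hp₁ : 1 ≤ p) (hp₂ : p ≤ 2)
    (hα₁ : 1 < α) (hα₂ : α < n) (hs : 0 ≤ s) (hC : 0 < C)
    (H : ∀ (f : SchwartzMap (E n) ℂ) (μ : Measure (E n)), IsFiniteMeasure μ →
        μ (Metric.ball (0 : E n) 1)ᶜ = 0 → frostman μ α < ⊤ →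
        (∫ t in (0:ℝ)..1, ∫ x, ‖halfWave (⇑f) t x‖ ^ p ∂μ) ^ (1/p) ≤
          C * (frostman μ α).toReal ^ (1/p) * sobolevNorm (⇑f) s) :
    ((n : ℝ) - α) / 2 - 1 / p ≤ s := by
  have hp0 : 0 < p := by linarith
  have hα0 : 0 < α := by linarith
  have hnR : (0 : ℝ) < n := by exact_mod_cast hn
  obtain ⟨C', hC'⟩ := strichartz_box hn hp₁ hp₂ hs hC H
  have hexp : -(n / α) + n / α * n * (p / 2) ≤ n * (p / 2) + n / α * (s * p) := by
    refine exponent_le_of_forall_nat (C := C') fun M hM => ?_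
    have hM0 : (0 : ℝ) < M := by exact_mod_cast hM
    have hM1 : (1 : ℝ) ≤ M := by exact_mod_cast hM
    have hR1 : 1 ≤ (M : ℝ) ^ (n / α) := Real.one_le_rpow hM1 (by positivity)
    set R : ℝ := (M : ℝ) ^ (n / α) with hR
    have hR0 : 0 < R := by linarith
    have hδ : (M : ℝ) ^ (-1 / (α / n)) = R⁻¹ := by
      rw [hR, ← Real.rpow_neg hM0.le]; congr 1; field_simp
    have := hC' (fun _ => M) (fun _ => α / n) (fun _ => R⁻¹) 0 R R⁻¹ (fun _ => hM)
      (fun _ => by positivity) (fun _ => by rw [div_le_one hnR]; exact hα₂.le)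
      (by simp only [Finset.sum_const, Finset.card_univ, Fintype.card_fin, nsmul_eq_mul]
          field_simp)
      (fun _ => hδ.symm) hR1 (by positivity) (inv_le_one_of_one_le₀ hR1) ?_
    · simp only [Finset.prod_const, Finset.card_univ, Fintype.card_fin, inv_inv] at this
      rw [Real.rpow_add hM0, Real.rpow_add hM0, Real.rpow_neg hM0.le, Real.rpow_mul hM0.le,
        Real.rpow_mul hM0.le, ← hR, Real.rpow_natCast, Real.rpow_mul hM0.le, Real.rpow_natCast,
        Real.rpow_mul hM0.le, ← hR]
      exact this
    · intro ξ hξ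
      have hn' : ‖ξ‖ ≤ R / 20 := by
        refine (norm_le_sum_abs ξ).trans ?_
        have : ∀ i, |ξ i| ≤ R / (20 * n) := fun i => by
          have h := hξ i
          rw [PiLp.zero_apply, sub_zero, abs_mul, abs_of_pos (by positivity),
            inv_mul_le_iff₀ hR0] at h
          linarith [mul_one_div R (20 * (n : ℝ))]
        refine (Finset.sum_le_sum fun i _ => this i).trans (le_of_eq ?_)
        simp only [Finset.sum_const, Finset.card_univ, Fintype.card_fin, nsmul_eq_mul]
        field_simp
      refine ⟨by linarith, fun t ht => ?_⟩
      rw [norm_zero, sub_zero, abs_norm]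
      calc t * ‖ξ‖ ≤ R⁻¹ * (R / 20) := by
            gcongr
            exact ht.2
        _ = 1 / 20 := by field_simp
  have h1 := mul_le_mul_of_nonneg_left hexp (show 0 ≤ α / n / p by positivity)
  have h2 : α / n / p * (-(n / α) + n / α * n * (p / 2)) = n / 2 - 1 / p := by
    field_simp; ring
  have h3 : α / n / p * (n * (p / 2) + n / α * (s * p)) = α / 2 + s := by
    field_simp
  rw [h2, h3] at h1
  linarith

/-- Many parallel plane-wave packets. -/
theorem le_of_strichartz_planar {k : ℕ} (hk : 0 < k) {p α s C : ℝ} (hp₁ : 1 ≤ p) (hp₂ : p ≤ 2)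
    (hα₁ : 1 < α) (hα₂ : α < (k + 1 : ℕ)) (hs : 0 ≤ s) (hC : 0 < C)
    (H : ∀ (f : SchwartzMap (E (k + 1)) ℂ) (μ : Measure (E (k + 1))), IsFiniteMeasure μ →
        μ (Metric.ball (0 : E (k + 1)) 1)ᶜ = 0 → frostman μ α < ⊤ →
        (∫ t in (0:ℝ)..1, ∫ x, ‖halfWave (⇑f) t x‖ ^ p ∂μ) ^ (1/p) ≤
          C * (frostman μ α).toReal ^ (1/p) * sobolevNorm (⇑f) s) :
    (((k + 1 : ℕ) : ℝ) - α) / 4 ≤ s := by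
  have hp0 : 0 < p := by linarith
  have hα0 : 0 < α - 1 := by linarith
  have hkR : (1 : ℝ) ≤ k := by exact_mod_cast hk
  push_cast at hα₂ ⊢
  obtain ⟨C', hC'⟩ := strichartz_box k.succ_pos hp₁ hp₂ hs hC H
  have hexp : k / (α - 1) * k * (p / 2) ≤ k * (p / 2) + k / (α - 1) * 2 * (s * p) := by
    refine exponent_le_of_forall_nat (C := C') fun M hM => ?_
    have hM0 : (0 : ℝ) < M := by exact_mod_cast hM
    have hM1 : (1 : ℝ) ≤ M := by exact_mod_cast hM
    have hρ1 : 1 ≤ (M : ℝ) ^ (k / (α - 1)) := Real.one_le_rpow hM1 (by positivity)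
    set ρ : ℝ := (M : ℝ) ^ (k / (α - 1)) with hρ
    have hρ0 : 0 < ρ := by linarith
    have hδ : (M : ℝ) ^ (-1 / ((α - 1) / k)) = ρ⁻¹ := by
      rw [hρ, ← Real.rpow_neg hM0.le]; congr 1; field_simp
    set ξ₀ : E (k + 1) := EuclideanSpace.single 0 (ρ ^ 2) with hξ₀
    have hnξ₀ : ‖ξ₀‖ = ρ ^ 2 := by
      rw [hξ₀, PiLp.norm_single, Real.norm_of_nonneg (by positivity)]
    have := hC' (Fin.cons 1 fun _ => M) (Fin.cons 1 fun _ => (α - 1) / k)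
      (Fin.cons 1 fun _ => ρ⁻¹) ξ₀ (ρ ^ 2) 1
      (Fin.cases (by simp) fun i => by simpa using hM)
      (Fin.cases (by simp) fun i => by simpa using by positivity)
      (Fin.cases (by simp) fun i => by
        simp only [Fin.cons_succ]; rw [div_le_one (by positivity)]; linarith)
      (by simp only [Fin.sum_univ_succ, Fin.cons_zero, Fin.cons_succ, Finset.sum_const,
            Finset.card_univ, Fintype.card_fin, nsmul_eq_mul]
          field_simp; ring)
      (Fin.cases (by simp) fun i => by simpa using hδ.symm) (one_le_pow₀ hρ1) zero_le_one le_rfl ?_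
    · simp only [Fin.prod_univ_succ, Fin.cons_zero, Fin.cons_succ, Finset.prod_const,
        Finset.card_univ, Fintype.card_fin, inv_inv, inv_one, one_mul, Nat.cast_one] at this
      rw [Real.rpow_add hM0, Real.rpow_mul hM0.le, Real.rpow_mul hM0.le, ← hρ, Real.rpow_natCast,
        Real.rpow_mul hM0.le, Real.rpow_natCast, Real.rpow_mul hM0.le, Real.rpow_mul hM0.le,
        ← hρ, Real.rpow_two]
      exact this
    · intro ξ hξ
      have h0 : |ξ 0 - ρ ^ 2| ≤ 1 / (20 * ((k + 1 : ℕ) : ℝ)) := by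
        simpa [hξ₀] using hξ 0
      have hS : ∀ i : Fin k, |ξ i.succ| ≤ ρ / (20 * ((k + 1 : ℕ) : ℝ)) := fun i => by
        have h := hξ i.succ
        rw [Fin.cons_succ, hξ₀, PiLp.single_apply, if_neg (Fin.succ_ne_zero i), sub_zero, abs_mul,
          abs_of_pos (by positivity), inv_mul_le_iff₀ hρ0, mul_one_div] at h
        exact h
      set c : ℝ := 1 / (20 * ((k + 1 : ℕ) : ℝ)) with hc
      have hc0 : 0 < c := by positivity
      have hck : c * (k + 1) = 1 / 20 := by rw [hc]; push_cast; field_simp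
      have hsq : ‖ξ‖ ^ 2 ≤ (ρ ^ 2 + c + k * c ^ 2) ^ 2 := by
        rw [EuclideanSpace.norm_sq_eq, Fin.sum_univ_succ]
        have h1 : ‖ξ 0‖ ^ 2 ≤ (ρ ^ 2 + c) ^ 2 := by
          rw [Real.norm_eq_abs]
          refine pow_le_pow_left₀ (abs_nonneg _) ?_ 2
          rw [abs_le] at h0 ⊢
          constructor <;> nlinarith
        have h2 : ∑ i : Fin k, ‖ξ i.succ‖ ^ 2 ≤ k * (ρ * c) ^ 2 := by
          have : ∀ i : Fin k, ‖ξ i.succ‖ ^ 2 ≤ (ρ * c) ^ 2 := fun i => by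
            rw [Real.norm_eq_abs]
            refine pow_le_pow_left₀ (abs_nonneg _) ?_ 2
            rw [hc, mul_one_div]
            exact hS i
          refine (Finset.sum_le_sum fun i _ => this i).trans (le_of_eq ?_)
          simp
        have h3 : 0 ≤ k * c ^ 2 := by positivity
        nlinarith [mul_nonneg h3 (sq_nonneg ρ), mul_nonneg h3 hc0.le, mul_nonneg h3 h3]
      have hup : ‖ξ‖ ≤ ρ ^ 2 + c + k * c ^ 2 :=
        (sq_le_sq₀ (norm_nonneg _) (by positivity)).1 hsq
      have hlo : ρ ^ 2 - c ≤ ‖ξ‖ := by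
        have := (le_abs_self _).trans (abs_apply_le_norm ξ 0)
        rw [abs_le] at h0
        linarith
      have hsmall : c + k * c ^ 2 ≤ 1 / 20 := by
        have hc1 : c ≤ 1 := by nlinarith
        nlinarith
      have hρ2 : 1 ≤ ρ ^ 2 := one_le_pow₀ hρ1
      refine ⟨by linarith, fun t ht => ?_⟩
      have habs : |‖ξ‖ - ‖ξ₀‖| ≤ 1 / 20 := by
        rw [hnξ₀, abs_le]
        have : 0 ≤ k * c ^ 2 := by positivity
        constructor <;> linarith
      calc t * |‖ξ‖ - ‖ξ₀‖| ≤ 1 * (1 / 20) := by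
            gcongr
            exact ht.2
        _ = 1 / 20 := one_mul _
  have h1 := mul_le_mul_of_nonneg_left hexp (show 0 ≤ (α - 1) / k * (2 / p) by positivity)
  have h2 : (α - 1) / k * (2 / p) * (k / (α - 1) * k * (p / 2)) = k := by
    field_simp
  have h3 : (α - 1) / k * (2 / p) * (k * (p / 2) + k / (α - 1) * 2 * (s * p))
      = α - 1 + 4 * s := by
    field_simp; ring
  rw [h2, h3] at h1
  linarith

/-- the condition `s ≥ max{(n-α)/2, (n+2-α)/4} - 1/p` is necessary for the
Strichartz estimate for the half-wave propagator with respect to fractal measures. -/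
theorem necessary_condition_strichartz_product (n : ℕ) (hn : 2 ≤ n) (p α s : ℝ)
    (hp₁ : 1 ≤ p) (hp₂ : p ≤ 2) (hα₁ : 1 < α) (hα₂ : α < n) (hs : 0 ≤ s)
    (H : ∃ C : ℝ, 0 < C ∧
      ∀ (f : SchwartzMap (E n) ℂ) (μ : Measure (E n)), IsFiniteMeasure μ →
        μ (Metric.ball (0 : E n) 1)ᶜ = 0 → frostman μ α < ⊤ →
        (∫ t in (0:ℝ)..1, ∫ x, ‖halfWave (⇑f) t x‖ ^ p ∂μ) ^ (1/p) ≤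
          C * (frostman μ α).toReal ^ (1/p) * sobolevNorm (⇑f) s) :
    max (((n : ℝ) - α) / 2) (((n : ℝ) + 2 - α) / 4) - 1/p ≤ s := by
  obtain ⟨C, hC, H⟩ := H
  have h1 := le_of_strichartz_focusing (by omega) hp₁ hp₂ hα₁ hα₂ hs hC H
  obtain ⟨k, rfl⟩ : ∃ k, n = k + 1 := ⟨n - 1, by omega⟩
  have h2 := le_of_strichartz_planar (by omega) hp₁ hp₂ hα₁ hα₂ hs hC H
  have h3 : 1 / 2 ≤ 1 / p := one_div_le_one_div_of_le (by linarith) hp₂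
  rw [sub_le_iff_le_add]
  refine max_le ?_ ?_ <;> linarith
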